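/- Let F be a field, V ⊆ F^{m×n} and W ⊆ F^{m×n'} rank support spaces, and φ : V → W a vector space isomorphism. Consider the properties: (P1) there exist an invertible matrix A ∈ F^{m×m} and a full-rank matrix B ∈ F^{n×n'} such that φ(C) = ACB for all C ∈ V; (P2) φ is a security equivalence, i.e., for every subspace U ⊆ V, U is a rank support space if and only if φ(U) is a rank support space; (P3) wt_R(φ(D)) = wt_R(D) for all subspaces D ⊆ V; (P4) φ is a rank isometry, i.e., Rk(φ(C)) = Rk(C) for all C ∈ V. Then (P1) ⟺ (P2) ⟺ (P3), and these imply (P4). -/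

import Mathlib

noncomputable section

open Matrix

variable {F : Type*} [Field F]

/-- The row space of a matrix: the span of its rows. -/
def rowSpace {m n : ℕ} (C : Matrix (Fin m) (Fin n) F) : Submodule F (Fin n → F) :=
  Submodule.span F (Set.range C)

/-- The rank of a matrix, as the dimension of its row space. -/
def Rk {m n : ℕ} (C : Matrix (Fin m) (Fin n) F) : ℕ :=
  Module.finrank F (rowSpace C)

/-- The rank support space of a subspace `L ⊆ F^n`:
all `m × n` matrices whose row space is contained in `L`. -/
def rss (m : ℕ) {n : ℕ} (L : Submodule F (Fin n → F)) :
    Submodule F (Matrix (Fin m) (Fin n) F) where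
  carrier := {V | rowSpace V ≤ L}
  add_mem' := by
    intro a b ha hb
    simp only [Set.mem_setOf_eq, rowSpace, Submodule.span_le] at *
    rintro x ⟨i, rfl⟩
    exact L.add_mem (ha (Set.mem_range_self i)) (hb (Set.mem_range_self i))
  zero_mem' := by
    simp only [Set.mem_setOf_eq, rowSpace, Submodule.span_le]
    rintro x ⟨i, rfl⟩
    exact L.zero_mem
  smul_mem' := by
    intro c a ha
    simp only [Set.mem_setOf_eq, rowSpace, Submodule.span_le] at *
    rintro x ⟨i, rfl⟩
    exact L.smul_mem c (ha (Set.mem_range_self i))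

/-- A rank support space in `F^{m×n}` is any subspace of the form `rss m L`. -/
def IsRSS {m n : ℕ} (V : Submodule F (Matrix (Fin m) (Fin n) F)) : Prop :=
  ∃ L : Submodule F (Fin n → F), V = rss m L

/-- The rank support of a subspace of matrices: the sum of the row spaces of its elements. -/
def RSupp {m n : ℕ} (D : Submodule F (Matrix (Fin m) (Fin n) F)) : Submodule F (Fin n → F) :=
  ⨆ C : D, rowSpace (C : Matrix (Fin m) (Fin n) F)

/-- The rank weight of a subspace of matrices. -/
def wtR {m n : ℕ} (D : Submodule F (Matrix (Fin m) (Fin n) F)) : ℕ :=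
  Module.finrank F (RSupp D)

/-- The image of a subspace `U ≤ V` under a vector space isomorphism `φ : V ≃ W`,
viewed as a subspace of the ambient space of `W`. -/
def mapThrough {M₁ M₂ : Type*} [AddCommGroup M₁] [Module F M₁] [AddCommGroup M₂] [Module F M₂]
    {V : Submodule F M₁} {W : Submodule F M₂} (φ : V ≃ₗ[F] W) (U : Submodule F M₁) :
    Submodule F M₂ :=
  Submodule.map (W.subtype.comp φ.toLinearMap) (U.comap V.subtype)

theorem rowSpace_le_iff {m n : ℕ} {C : Matrix (Fin m) (Fin n) F} {L : Submodule F (Fin n → F)} :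
    rowSpace C ≤ L ↔ ∀ i, C i ∈ L := by
  rw [rowSpace, Submodule.span_le]
  exact Set.range_subset_iff

theorem mem_rss {m n : ℕ} {C : Matrix (Fin m) (Fin n) F} {L : Submodule F (Fin n → F)} :
    C ∈ rss m L ↔ ∀ i, C i ∈ L :=
  rowSpace_le_iff

theorem rSupp_le_iff {m n : ℕ} {D : Submodule F (Matrix (Fin m) (Fin n) F)}
    {L : Submodule F (Fin n → F)} : RSupp D ≤ L ↔ D ≤ rss m L := by
  rw [RSupp, iSup_le_iff]
  exact ⟨fun h C hC => h ⟨C, hC⟩, fun h C => h C.2⟩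

theorem rss_mono {m n : ℕ} {L₁ L₂ : Submodule F (Fin n → F)} (h : L₁ ≤ L₂) :
    rss m L₁ ≤ rss m L₂ :=
  fun _ hC => mem_rss.2 fun i => h (mem_rss.1 hC i)

theorem row_mem_rSupp {m n : ℕ} {D : Submodule F (Matrix (Fin m) (Fin n) F)}
    {C : Matrix (Fin m) (Fin n) F} (hC : C ∈ D) (i : Fin m) : C i ∈ RSupp D :=
  mem_rss.1 (rSupp_le_iff.1 le_rfl hC) i

theorem vecMulVec_mem_rss {m n : ℕ} {L : Submodule F (Fin n → F)} (a : Fin m → F)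
    {x : Fin n → F} (hx : x ∈ L) : vecMulVec a x ∈ rss m L :=
  mem_rss.2 fun i => L.smul_mem (a i) hx

theorem vecMulVec_zero_right {m n : ℕ} (a : Fin m → F) :
    vecMulVec a (0 : Fin n → F) = 0 :=
  Matrix.ext fun _ _ => mul_zero _

theorem vecMulVec_eq_zero_iff {m n : ℕ} {a : Fin m → F} {x : Fin n → F} :
    vecMulVec a x = 0 ↔ a = 0 ∨ x = 0 := by
  simp only [← Matrix.ext_iff, vecMulVec_apply, Matrix.zero_apply, mul_eq_zero, funext_iff,
    Pi.zero_apply, forall_or_left, forall_or_right]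

theorem rSupp_rss {m n : ℕ} (hm : 0 < m) (L : Submodule F (Fin n → F)) :
    RSupp (rss m L) = L := by
  refine le_antisymm (rSupp_le_iff.2 le_rfl) fun x hx => ?_
  have h := row_mem_rSupp (vecMulVec_mem_rss (m := m) 1 hx) ⟨0, hm⟩
  rwa [show vecMulVec (1 : Fin m → F) x ⟨0, hm⟩ = x by ext j; simp [vecMulVec_apply]] at h

theorem finrank_rss (m : ℕ) {n : ℕ} (L : Submodule F (Fin n → F)) :
    Module.finrank F (rss m L) = m * Module.finrank F L := by
  let e : rss m L ≃ₗ[F] (Fin m → L) :=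
    { toFun := fun C i => ⟨C.1 i, mem_rss.1 C.2 i⟩
      invFun := fun v => ⟨fun i => (v i : Fin n → F), mem_rss.2 fun i => (v i).2⟩
      map_add' := fun _ _ => rfl
      map_smul' := fun _ _ => rfl
      left_inv := fun _ => rfl
      right_inv := fun _ => rfl }
  rw [e.finrank_eq, Module.finrank_pi_fintype]
  simp

theorem isRSS_iff_finrank_eq {m n : ℕ} {U : Submodule F (Matrix (Fin m) (Fin n) F)} :
    IsRSS U ↔ Module.finrank F U = m * wtR U := by
  constructor
  · rintro ⟨L, rfl⟩
    rcases Nat.eq_zero_or_pos m with rfl | hm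
    · simpa using finrank_rss 0 L
    · rw [wtR, rSupp_rss hm, finrank_rss]
  · intro h
    exact ⟨RSupp U, Submodule.eq_of_le_of_finrank_eq (rSupp_le_iff.1 le_rfl)
      (h.trans (finrank_rss m _).symm)⟩

theorem wtR_span_singleton {m n : ℕ} (C : Matrix (Fin m) (Fin n) F) :
    wtR (Submodule.span F {C}) = Rk C := by
  have h : RSupp (Submodule.span F {C}) = rowSpace C := by
    refine le_antisymm (rSupp_le_iff.2 ?_) ?_
    · rw [Submodule.span_singleton_le_iff_mem, mem_rss]
      exact rowSpace_le_iff.1 le_rfl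
    · exact rowSpace_le_iff.2 (row_mem_rSupp (Submodule.mem_span_singleton_self C))
  rw [wtR, h, Rk]

theorem finrank_map_of_forall_eq_zero {M N : Type*} [AddCommGroup M] [Module F M]
    [AddCommGroup N] [Module F N] (f : M →ₗ[F] N) (p : Submodule F M)
    (h : ∀ x ∈ p, f x = 0 → x = 0) : Module.finrank F (p.map f) = Module.finrank F p := by
  rw [← LinearMap.range_domRestrict]
  refine LinearMap.finrank_range_of_inj ((injective_iff_map_eq_zero _).2 fun x hx => ?_)
  exact Subtype.ext (h x x.2 hx)

theorem exists_linearMap_finrank_range_eq_min (M N : Type*) [AddCommGroup M] [Module F M]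
    [AddCommGroup N] [Module F N] [Module.Finite F M] [Module.Finite F N] :
    ∃ h : M →ₗ[F] N, Module.finrank F (LinearMap.range h) =
      min (Module.finrank F M) (Module.finrank F N) := by
  rcases le_total (Module.finrank F M) (Module.finrank F N) with hle | hle
  · obtain ⟨h, hh⟩ := finrank_le_iff_exists_linearMap.1 hle
    exact ⟨h, by rw [LinearMap.finrank_range_of_inj hh, min_eq_left hle]⟩
  · obtain ⟨h, hh⟩ := finrank_le_iff_exists_linearMap.1 hle
    obtain ⟨g, hg⟩ := h.exists_leftInverse_of_injective (LinearMap.ker_eq_bot.2 hh)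
    have hs : LinearMap.range g = ⊤ := LinearMap.range_eq_top.2 fun x =>
      ⟨h x, LinearMap.congr_fun hg x⟩
    exact ⟨g, by rw [hs, finrank_top, min_eq_right hle]⟩

/-- An injective linear map on a subspace extends to a linear map of full rank. -/
theorem exists_extend_finrank_range_eq_min {M N : Type*} [AddCommGroup M] [Module F M]
    [AddCommGroup N] [Module F N] [Module.Finite F M] [Module.Finite F N]
    (L : Submodule F M) (f : L →ₗ[F] N) (hf : Function.Injective f) :
    ∃ g : M →ₗ[F] N, (∀ x : L, g x = f x) ∧ Module.finrank F (LinearMap.range g) =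
      min (Module.finrank F M) (Module.finrank F N) := by
  obtain ⟨L', hL⟩ := L.exists_isCompl
  obtain ⟨R', hR⟩ := (LinearMap.range f).exists_isCompl
  obtain ⟨h, hh⟩ := exists_linearMap_finrank_range_eq_min (F := F) L' R'
  refine ⟨LinearMap.ofIsCompl hL f (R'.subtype ∘ₗ h),
    fun x => LinearMap.ofIsCompl_apply_left hL x, ?_⟩
  rw [LinearMap.range_ofIsCompl, LinearMap.range_comp]
  have hle : (LinearMap.range h).map R'.subtype ≤ R' := Submodule.map_subtype_le _ _
  have hdis : LinearMap.range f ⊓ (LinearMap.range h).map R'.subtype = ⊥ :=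
    (hR.disjoint.mono_right hle).eq_bot
  have h1 := Submodule.finrank_sup_add_finrank_inf_eq (LinearMap.range f)
    ((LinearMap.range h).map R'.subtype)
  rw [hdis, finrank_bot, Submodule.finrank_map_subtype_eq, hh,
    LinearMap.finrank_range_of_inj hf] at h1
  have h2 := Submodule.finrank_add_eq_of_isCompl hL
  have h3 := Submodule.finrank_add_eq_of_isCompl hR
  rw [LinearMap.finrank_range_of_inj hf] at h3
  omega

theorem rk_transpose_toMatrix' {n n' : ℕ} (g : (Fin n → F) →ₗ[F] (Fin n' → F)) :
    Rk (LinearMap.toMatrix' g)ᵀ = Module.finrank F (LinearMap.range g) := by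
  have h : rowSpace (LinearMap.toMatrix' g)ᵀ = LinearMap.range g := by
    change Submodule.span F (Set.range ((LinearMap.toMatrix' g)ᵀ).row) = _
    rw [← range_vecMulLinear, vecMulLinear_transpose, ← Matrix.toLin'_apply']
    rw [Matrix.toLin'_toMatrix']
  rw [Rk, h]

theorem sum_vecMulVec_single {m n : ℕ} (C : Matrix (Fin m) (Fin n) F) :
    ∑ i, vecMulVec (Pi.single i 1) (C i) = C := by
  ext i j
  simp [Matrix.sum_apply, vecMulVec_apply, Pi.single_apply]

section

variable {m n n' : ℕ} {L : Submodule F (Fin n → F)}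
  {Φ : Matrix (Fin m) (Fin n) F →ₗ[F] Matrix (Fin m) (Fin n') F}

theorem wtR_map_mul (hm : 0 < m) (hΦ : ∀ C ∈ rss m L, Φ C = 0 → C = 0)
    {A : Matrix (Fin m) (Fin m) F} {B : Matrix (Fin n) (Fin n') F} (hA : IsUnit A)
    (h : ∀ C ∈ rss m L, Φ C = A * C * B) {D : Submodule F (Matrix (Fin m) (Fin n) F)}
    (hD : D ≤ rss m L) : wtR (D.map Φ) = wtR D := by
  have hB : ∀ x ∈ L, x ᵥ* B = 0 → x = 0 := by
    intro x hx hxB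
    have hmem := vecMulVec_mem_rss (1 : Fin m → F) hx
    have h0 := hΦ _ hmem (by rw [h _ hmem, mul_vecMulVec, vecMulVec_mul, hxB, vecMulVec_zero_right])
    refine (vecMulVec_eq_zero_iff.1 h0).resolve_left fun h1 => ?_
    exact one_ne_zero (congrFun h1 ⟨0, hm⟩)
  have hmul : ∀ {k l p : ℕ} (P : Matrix (Fin k) (Fin l) F) (Q : Matrix (Fin l) (Fin p) F) (i),
      (P * Q) i = P i ᵥ* Q := fun _ _ _ => rfl
  have hsupp : RSupp (D.map Φ) = (RSupp D).map B.vecMulLinear := by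
    refine le_antisymm (rSupp_le_iff.2 ?_) (Submodule.map_le_iff_le_comap.2 (rSupp_le_iff.2 ?_))
    · rintro _ ⟨C, hC, rfl⟩
      rw [h C (hD hC)]
      refine mem_rss.2 fun i => ⟨(A * C) i, ?_, rfl⟩
      rw [hmul, vecMul_eq_sum]
      exact Submodule.sum_mem _ fun j _ => Submodule.smul_mem _ _ (row_mem_rSupp hC j)
    · intro C hC
      refine mem_rss.2 fun i => ?_
      have hCB : C * B = (↑hA.unit⁻¹ : Matrix (Fin m) (Fin m) F) * Φ C := by
        rw [h C (hD hC), Matrix.mul_assoc A, ← Matrix.mul_assoc, hA.val_inv_mul, Matrix.one_mul]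
      change (C * B) i ∈ RSupp (D.map Φ)
      rw [hCB, hmul, vecMul_eq_sum]
      exact Submodule.sum_mem _ fun j _ => Submodule.smul_mem _ _
        (row_mem_rSupp (Submodule.mem_map_of_mem hC) j)
  rw [wtR, hsupp, finrank_map_of_forall_eq_zero, wtR]
  exact fun x hx => hB x (rSupp_le_iff.2 hD hx)

theorem exists_map_vecMulVec_eq (hm : 0 < m) (hΦ : ∀ C ∈ rss m L, Φ C = 0 → C = 0)
    (h : ∀ U ≤ rss m L, IsRSS U → IsRSS (U.map Φ)) {x : Fin n → F} (hx : x ∈ L) (hx0 : x ≠ 0) :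
    ∃ (T : (Fin m → F) →ₗ[F] (Fin m → F)) (y : Fin n' → F), Function.Injective T ∧
      ∀ a, Φ (vecMulVec a x) = vecMulVec (T a) y := by
  have hle : rss m (F ∙ x) ≤ rss m L := rss_mono ((Submodule.span_singleton_le_iff_mem _ _).2 hx)
  obtain ⟨L₁, hL₁⟩ := h _ hle ⟨_, rfl⟩
  have hfin : Module.finrank F L₁ = 1 := by
    have h1 := finrank_map_of_forall_eq_zero Φ _ fun C hC => hΦ C (hle hC)
    rw [hL₁, finrank_rss, finrank_rss, finrank_span_singleton hx0] at h1
    exact Nat.eq_of_mul_eq_mul_left hm h1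
  obtain ⟨y, hy0, hy⟩ := finrank_eq_one_iff'.1 hfin
  obtain ⟨j, hj⟩ : ∃ j, (y : Fin n' → F) j ≠ 0 := by
    by_contra! hcon
    exact hy0 (Subtype.ext (funext hcon))
  let T : (Fin m → F) →ₗ[F] (Fin m → F) :=
    { toFun := fun a i => Φ (vecMulVec a x) i j / (y : Fin n' → F) j
      map_add' := fun a b => by ext i; simp [add_vecMulVec, add_div]
      map_smul' := fun c a => by ext i; simp [smul_vecMulVec, mul_div_assoc] }
  have hT : ∀ a, Φ (vecMulVec a x) = vecMulVec (T a) y := by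
    intro a
    ext i k
    have hmem : Φ (vecMulVec a x) ∈ rss m L₁ := hL₁ ▸ Submodule.mem_map_of_mem
      (vecMulVec_mem_rss a (Submodule.mem_span_singleton_self x))
    obtain ⟨c, hc⟩ := hy ⟨_, mem_rss.1 hmem i⟩
    have hc' : ∀ l, Φ (vecMulVec a x) i l = c * (y : Fin n' → F) l := fun l =>
      (congrFun (congrArg Subtype.val hc) l).symm
    simp only [vecMulVec_apply, T, LinearMap.coe_mk, AddHom.coe_mk, hc']
    rw [mul_div_cancel_right₀ _ hj]
  refine ⟨T, y, (injective_iff_map_eq_zero _).2 fun a ha => ?_, hT⟩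
  have h0 := hΦ _ (vecMulVec_mem_rss a hx) (by rw [hT, ha, zero_vecMulVec])
  exact (vecMulVec_eq_zero_iff.1 h0).resolve_right hx0

/-- The column transformations attached to two independent row vectors are proportional. -/
theorem exists_eq_smul_of_map_vecMulVec_eq (hm : 0 < m)
    (hΦ : ∀ C ∈ rss m L, Φ C = 0 → C = 0)
    (h : ∀ U ≤ rss m L, IsRSS U → IsRSS (U.map Φ)) {x₁ x₂ : Fin n → F} (hx₁ : x₁ ∈ L)
    (hx₂ : x₂ ∈ L) (hind : LinearIndependent F ![x₁, x₂])
    {T₁ T₂ : (Fin m → F) →ₗ[F] (Fin m → F)} {y₁ y₂ : Fin n' → F}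
    (hT₁ : Function.Injective T₁) (hT₂ : Function.Injective T₂)
    (h₁ : ∀ a, Φ (vecMulVec a x₁) = vecMulVec (T₁ a) y₁)
    (h₂ : ∀ a, Φ (vecMulVec a x₂) = vecMulVec (T₂ a) y₂) :
    ∃ s : F, T₂ = s • T₁ := by
  rw [LinearIndependent.pair_iff] at hind
  have hy : ∀ s t : F, s • y₁ + t • y₂ = 0 → s = 0 ∧ t = 0 := by
    intro s t hst
    obtain ⟨a₁, ha₁⟩ := LinearMap.injective_iff_surjective.1 hT₁ (fun _ => s)
    obtain ⟨a₂, ha₂⟩ := LinearMap.injective_iff_surjective.1 hT₂ (fun _ => t)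
    have h0 := hΦ _ ((rss m L).add_mem (vecMulVec_mem_rss a₁ hx₁) (vecMulVec_mem_rss a₂ hx₂)) (by
      rw [map_add, h₁, h₂, ha₁, ha₂]
      ext i j
      simpa [vecMulVec_apply] using congrFun hst j)
    have ha : ∀ i, a₁ i = 0 ∧ a₂ i = 0 := fun i => hind _ _ (congrFun h0 i)
    have e₁ : a₁ = 0 := funext fun i => (ha i).1
    have e₂ : a₂ = 0 := funext fun i => (ha i).2
    rw [e₁, map_zero] at ha₁
    rw [e₂, map_zero] at ha₂
    exact ⟨(congrFun ha₁ ⟨0, hm⟩).symm, (congrFun ha₂ ⟨0, hm⟩).symm⟩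
  have hne : x₁ + x₂ ≠ 0 := fun h0 => one_ne_zero (hind 1 1 (by simpa using h0)).1
  obtain ⟨T, y, hT, hTy⟩ := exists_map_vecMulVec_eq hm hΦ h (L.add_mem hx₁ hx₂) hne
  have hsum : ∀ a i, T a i • y = T₁ a i • y₁ + T₂ a i • y₂ := by
    intro a i
    have h3 := hTy a
    rw [vecMulVec_add, map_add, h₁, h₂] at h3
    exact (congrFun h3 i).symm
  obtain ⟨a₀, ha₀⟩ := LinearMap.injective_iff_surjective.1 hT (fun _ => 1)
  obtain ⟨α, β, hαβ⟩ : ∃ α β : F, y = α • y₁ + β • y₂ :=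
    ⟨_, _, by simpa [ha₀] using hsum a₀ ⟨0, hm⟩⟩
  have hcoef : ∀ a i, T₁ a i = T a i * α ∧ T₂ a i = T a i * β := by
    intro a i
    have h3 := hsum a i
    rw [hαβ] at h3
    have h4 := hy (T₁ a i - T a i * α) (T₂ a i - T a i * β) (by
      rw [sub_smul, sub_smul, sub_add_sub_comm, ← h3, smul_add, smul_smul, smul_smul, sub_self])
    exact ⟨sub_eq_zero.1 h4.1, sub_eq_zero.1 h4.2⟩
  have hα : α ≠ 0 := by
    rintro rfl
    have h5 : T₁ (fun _ => 1) = 0 := funext fun i => by simpa using (hcoef _ i).1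
    exact one_ne_zero (congrFun ((map_eq_zero_iff _ hT₁).1 h5) ⟨0, hm⟩)
  refine ⟨β / α, LinearMap.ext fun a => funext fun i => ?_⟩
  simp only [LinearMap.smul_apply, Pi.smul_apply, smul_eq_mul, (hcoef a i).1, (hcoef a i).2]
  field_simp

theorem exists_mul_of_map_isRSS (hΦ : ∀ C ∈ rss m L, Φ C = 0 → C = 0)
    (h : ∀ U ≤ rss m L, IsRSS U → IsRSS (U.map Φ)) :
    ∃ (A : Matrix (Fin m) (Fin m) F) (B : Matrix (Fin n) (Fin n') F),
      IsUnit A ∧ Rk B = min n n' ∧ ∀ C ∈ rss m L, Φ C = A * C * B := by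
  obtain ⟨T, f, hT, hf, hTf⟩ : ∃ (T : (Fin m → F) →ₗ[F] (Fin m → F))
      (f : (Fin n → F) →ₗ[F] (Fin n' → F)), Function.Injective T ∧
      Module.finrank F (LinearMap.range f) = min n n' ∧
      ∀ x ∈ L, ∀ a, Φ (vecMulVec a x) = vecMulVec (T a) (f x) := by
    rcases Nat.eq_zero_or_pos m with rfl | hm
    · obtain ⟨f, hf⟩ := exists_linearMap_finrank_range_eq_min (F := F) (Fin n → F) (Fin n' → F)
      exact ⟨LinearMap.id, f, Function.injective_id, by simpa using hf,
        fun _ _ _ => Subsingleton.elim _ _⟩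
    let b := Module.finBasis F L
    choose T y hT hTy using fun j => exists_map_vecMulVec_eq hm hΦ h (b j).2
      (fun h0 => b.ne_zero j (Subtype.ext h0))
    obtain ⟨S, z, hS, hSz⟩ : ∃ (S : (Fin m → F) →ₗ[F] (Fin m → F)) (z : _ → Fin n' → F),
        Function.Injective S ∧ ∀ j a, Φ (vecMulVec a (b j)) = vecMulVec (S a) (z j) := by
      rcases isEmpty_or_nonempty (Fin (Module.finrank F L)) with _ | ⟨⟨j₀⟩⟩
      · exact ⟨LinearMap.id, fun _ => 0, Function.injective_id, fun j => isEmptyElim j⟩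
      have hs : ∀ j, ∃ s : F, T j = s • T j₀ := by
        intro j
        rcases eq_or_ne j₀ j with rfl | hj
        · exact ⟨1, (one_smul _ _).symm⟩
        refine exists_eq_smul_of_map_vecMulVec_eq hm hΦ h (b j₀).2 (b j).2 ?_ (hT j₀) (hT j)
          (hTy j₀) (hTy j)
        have hp := (b.linearIndependent.map' L.subtype L.ker_subtype).comp ![j₀, j]
          (by simpa [Function.Injective, Fin.forall_fin_two] using ⟨hj, hj.symm⟩)
        have hv : ![(b j₀ : Fin n → F), b j] = (L.subtype ∘ b) ∘ ![j₀, j] := by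
          ext i : 1
          fin_cases i <;> rfl
        rwa [hv]
      choose s hs using hs
      refine ⟨T j₀, fun j => s j • y j, hT j₀, fun j a => ?_⟩
      rw [hTy, hs j, LinearMap.smul_apply, smul_vecMulVec, vecMulVec_smul]
    let f₀ : L →ₗ[F] (Fin n' → F) := b.constr F z
    have key : ∀ a (x : L), Φ (vecMulVec a x) = vecMulVec (S a) (f₀ x) := by
      intro a x
      have hlin : (Φ ∘ₗ vecMulVecBilin F F a) ∘ₗ L.subtype =
          vecMulVecBilin F F (S a) ∘ₗ f₀ :=
        b.ext fun j => by simpa [f₀] using hSz j a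
      exact LinearMap.congr_fun hlin x
    have hf₀ : Function.Injective f₀ := (injective_iff_map_eq_zero _).2 fun x hx => by
      have h0 := hΦ _ (vecMulVec_mem_rss 1 x.2) (by rw [key, hx, vecMulVec_zero_right])
      refine Subtype.ext ((vecMulVec_eq_zero_iff.1 h0).resolve_left fun h1 => ?_)
      exact one_ne_zero (congrFun h1 ⟨0, hm⟩)
    obtain ⟨g, hg, hgr⟩ := exists_extend_finrank_range_eq_min L f₀ hf₀
    exact ⟨S, g, hS, by simpa using hgr, fun x hx a => by rw [key a ⟨x, hx⟩, ← hg]⟩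
  refine ⟨LinearMap.toMatrix' T, (LinearMap.toMatrix' f)ᵀ, ?_,
    (rk_transpose_toMatrix' f).trans hf, fun C hC => ?_⟩
  · rw [← mulVec_injective_iff_isUnit]
    intro a b hab
    exact hT (by simpa only [LinearMap.toMatrix'_mulVec] using hab)
  · conv_lhs => rw [← sum_vecMulVec_single C]
    conv_rhs => rw [← sum_vecMulVec_single C]
    rw [map_sum, Matrix.mul_sum, Matrix.sum_mul]
    refine Finset.sum_congr rfl fun i _ => ?_
    rw [hTf _ (mem_rss.1 hC i), mul_vecMulVec, vecMulVec_mul, vecMul_transpose,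
      LinearMap.toMatrix'_mulVec, LinearMap.toMatrix'_mulVec]

end

/-- For a vector space isomorphism `φ : V → W` between rank support spaces
`V ⊆ F^{m×n}` and `W ⊆ F^{m×n'}`, the properties (P1) `φ(C) = A C B` for an invertible `A` and a
full-rank `B`, (P2) `φ` is a security equivalence, and (P3) `φ` preserves rank weights of
subspaces, are all equivalent, and they imply (P4) `φ` is a rank isometry. -/
theorem stmt_13 (m n n' : ℕ) (V : Submodule F (Matrix (Fin m) (Fin n) F))
    (W : Submodule F (Matrix (Fin m) (Fin n') F)) (hV : IsRSS V) (hW : IsRSS W)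
    (φ : V ≃ₗ[F] W) :
    ((∃ (A : Matrix (Fin m) (Fin m) F) (B : Matrix (Fin n) (Fin n') F),
        IsUnit A ∧ Rk B = min n n' ∧
        ∀ C : V, (φ C : Matrix (Fin m) (Fin n') F) = A * (C : Matrix (Fin m) (Fin n) F) * B) ↔
      (∀ U : Submodule F (Matrix (Fin m) (Fin n) F), U ≤ V →
        (IsRSS U ↔ IsRSS (mapThrough φ U)))) ∧
    ((∀ U : Submodule F (Matrix (Fin m) (Fin n) F), U ≤ V →
        (IsRSS U ↔ IsRSS (mapThrough φ U))) ↔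
      (∀ D : Submodule F (Matrix (Fin m) (Fin n) F), D ≤ V →
        wtR (mapThrough φ D) = wtR D)) ∧
    ((∀ D : Submodule F (Matrix (Fin m) (Fin n) F), D ≤ V →
        wtR (mapThrough φ D) = wtR D) →
      ∀ C : V, Rk (φ C : Matrix (Fin m) (Fin n') F) = Rk (C : Matrix (Fin m) (Fin n) F)) := by
  obtain ⟨Φ, hΦφ⟩ := LinearMap.exists_extend (W.subtype ∘ₗ φ.toLinearMap)
  have hφ : ∀ C : V, (φ C : Matrix (Fin m) (Fin n') F) = Φ C := fun C =>
    (LinearMap.congr_fun hΦφ C).symm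
  have hmap : ∀ U ≤ V, mapThrough φ U = U.map Φ := by
    intro U hU
    rw [mapThrough, ← hΦφ, Submodule.map_comp, Submodule.map_comap_subtype, inf_eq_right.2 hU]
  have hΦ : ∀ C ∈ V, Φ C = 0 → C = 0 := by
    intro C hC h0
    have h1 : φ ⟨C, hC⟩ = 0 := Subtype.ext ((hφ ⟨C, hC⟩).trans h0)
    exact congrArg Subtype.val (φ.map_eq_zero_iff.1 h1)
  obtain ⟨L, rfl⟩ := hV
  have h13 : (∃ (A : Matrix (Fin m) (Fin m) F) (B : Matrix (Fin n) (Fin n') F),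
        IsUnit A ∧ Rk B = min n n' ∧
        ∀ C : rss m L, (φ C : Matrix (Fin m) (Fin n') F) =
          A * (C : Matrix (Fin m) (Fin n) F) * B) →
      ∀ D : Submodule F (Matrix (Fin m) (Fin n) F), D ≤ rss m L →
        wtR (mapThrough φ D) = wtR D := by
    rintro ⟨A, B, hA, -, hAB⟩ D hD
    rcases Nat.eq_zero_or_pos m with rfl | hm
    · have hbot : ∀ {k : ℕ} (E : Submodule F (Matrix (Fin 0) (Fin k) F)), wtR E = 0 := fun E => by
        rw [wtR, eq_bot_iff.2 (rSupp_le_iff.2 fun C _ => mem_rss.2 fun i => i.elim0), finrank_bot]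
      rw [hbot, hbot]
    · rw [hmap D hD]
      exact wtR_map_mul hm hΦ hA (fun C hC => (hφ ⟨C, hC⟩).symm.trans (hAB ⟨C, hC⟩)) hD
  have h32 : (∀ D : Submodule F (Matrix (Fin m) (Fin n) F), D ≤ rss m L →
        wtR (mapThrough φ D) = wtR D) →
      ∀ U : Submodule F (Matrix (Fin m) (Fin n) F), U ≤ rss m L →
        (IsRSS U ↔ IsRSS (mapThrough φ U)) := by
    intro h U hU
    rw [isRSS_iff_finrank_eq, isRSS_iff_finrank_eq, h U hU, hmap U hU,
      finrank_map_of_forall_eq_zero Φ U fun C hC => hΦ C (hU hC)]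
  have h21 : (∀ U : Submodule F (Matrix (Fin m) (Fin n) F), U ≤ rss m L →
        (IsRSS U ↔ IsRSS (mapThrough φ U))) →
      ∃ (A : Matrix (Fin m) (Fin m) F) (B : Matrix (Fin n) (Fin n') F),
        IsUnit A ∧ Rk B = min n n' ∧
        ∀ C : rss m L, (φ C : Matrix (Fin m) (Fin n') F) =
          A * (C : Matrix (Fin m) (Fin n) F) * B := by
    intro h
    obtain ⟨A, B, hA, hB, hAB⟩ := exists_mul_of_map_isRSS hΦ
      fun U hU hR => hmap U hU ▸ (h U hU).1 hR
    exact ⟨A, B, hA, hB, fun C => (hφ C).trans (hAB C C.2)⟩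
  refine ⟨⟨fun h => h32 (h13 h), h21⟩, ⟨fun h => h13 (h21 h), h32⟩, fun h C => ?_⟩
  have hle : Submodule.span F {(C : Matrix (Fin m) (Fin n) F)} ≤ rss m L :=
    (Submodule.span_singleton_le_iff_mem _ _).2 C.2
  have hC := h _ hle
  rwa [hmap _ hle, Submodule.map_span, Set.image_singleton, wtR_span_singleton,
    wtR_span_singleton, ← hφ] at hC

end
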